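/- Weyl's lemma: if u : Ω → ℝ is locally integrable on an open set Ω ⊆ ℝⁿ and ∫_Ω (Δφ) u = 0 for every φ ∈ C_c^∞(Ω), then u agrees almost everywhere with a C^∞ (indeed harmonic, hence real analytic) function on Ω. -/

import Mathlib

open MeasureTheory

/-- The Laplacian of a function on `ℝⁿ`, as a sum of iterated directional derivatives. -/
noncomputable def lapE (n : ℕ) (φ : EuclideanSpace ℝ (Fin n) → ℝ)
    (p : EuclideanSpace ℝ (Fin n)) : ℝ :=
  ∑ i : Fin n, fderiv ℝ (fun q => fderiv ℝ φ q (EuclideanSpace.single i 1)) p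
    (EuclideanSpace.single i 1)

section partC
open Metric Set Filter Topology
open scoped ContDiff Nat

theorem weyl_analyticAt_of_bounds {E F : Type*} [NormedAddCommGroup E] [NormedSpace ℝ E]
    [NormedAddCommGroup F] [NormedSpace ℝ F] [CompleteSpace F]
    (f : E → F) (x : E) {ρ M A : ℝ} (hρ : 0 < ρ) (hA : 0 < A)
    (hf : ContDiffOn ℝ (⊤ : ℕ∞) f (ball x ρ))
    (hb : ∀ k : ℕ, ∀ y ∈ ball x ρ, ‖iteratedFDeriv ℝ k f y‖ ≤ M * A ^ k * (k ! : ℝ)) :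
    AnalyticAt ℝ f x := by
  have hx : x ∈ ball x ρ := mem_ball_self hρ
  let p : FormalMultilinearSeries ℝ E F := fun k => (k ! : ℝ)⁻¹ • iteratedFDeriv ℝ k f x
  have hM : 0 ≤ M := by
    have := (norm_nonneg _).trans (hb 0 x hx)
    simpa using this
  have hp : ∀ k, ‖p k‖ ≤ M * A ^ k := by
    intro k
    have hk : (0:ℝ) < (k ! : ℝ) := by positivity
    simp only [p, norm_smul, norm_inv, Real.norm_natCast]
    rw [inv_mul_le_iff₀ hk]
    linarith [hb k x hx]
  let r : NNReal := ⟨min ρ (A⁻¹), by positivity⟩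
  have hr0 : 0 < r := by
    rw [← NNReal.coe_pos]; exact lt_min hρ (inv_pos.2 hA)
  have hrρ : (r:ℝ) ≤ ρ := min_le_left _ _
  have hrA : A * (r:ℝ) ≤ 1 := by
    have : (r:ℝ) ≤ A⁻¹ := min_le_right _ _
    calc A * (r:ℝ) ≤ A * A⁻¹ := by gcongr
      _ = 1 := mul_inv_cancel₀ hA.ne'
  refine ⟨p, r, ?_, by exact_mod_cast hr0, ?_⟩
  · apply p.le_radius_of_bound M
    intro k
    calc ‖p k‖ * (r:ℝ)^k ≤ M * A ^ k * (r:ℝ)^k := by gcongr; exact hp k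
      _ = M * (A * r)^k := by rw [mul_pow]; ring
      _ ≤ M * 1 := by
        gcongr
        exact pow_le_one₀ (by positivity) hrA
      _ = M := mul_one M
  · intro y hy
    have hy' : ‖y‖ < r := by
      have : y ∈ ball (0:E) r := by
        rw [← Metric.eball_coe]; exact hy
      simpa using this
    have hq0 : 0 ≤ A * ‖y‖ := by positivity
    have hq : A * ‖y‖ < 1 := lt_of_lt_of_le (by gcongr) hrA
    have hpy : ∀ k, ‖p k (fun _ => y)‖ ≤ M * (A * ‖y‖)^k := by
      intro k
      calc ‖p k (fun _ => y)‖ ≤ ‖p k‖ * ‖y‖ ^ k := by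
            simpa using (p k).le_opNorm (fun _ => y)
        _ ≤ M * A ^ k * ‖y‖^k := by gcongr; exact hp k
        _ = _ := by rw [mul_pow]; ring
    have hsum : Summable (fun k => p k (fun _ => y)) :=
      Summable.of_norm_bounded ((summable_geometric_of_lt_one hq0 hq).mul_left M) hpy
    rw [hsum.hasSum_iff_tendsto_nat, ← tendsto_add_atTop_iff_nat 1]
    have hseg : ∀ t ∈ Icc (0:ℝ) 1, x + t • y ∈ ball x ρ := by
      intro t ht
      rw [mem_ball, dist_eq_norm, add_sub_cancel_left, norm_smul, Real.norm_of_nonneg ht.1]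
      calc t * ‖y‖ ≤ 1 * ‖y‖ := by gcongr; exact ht.2
        _ < ρ := by linarith
    have key : ∀ n : ℕ, ‖(∑ k ∈ Finset.range (n+1), p k (fun _ => y)) - f (x + y)‖
        ≤ M * (((n+1 : ℕ) : ℝ) * (A * ‖y‖)^(n+1)) := by
      intro n
      have hT := map_add_eq_sum_add_integral_iteratedFDeriv (f := f) (x := x) (y := y) (n := n)
        (fun t ht => ((hf.contDiffAt (isOpen_ball.mem_nhds (hseg t ht))).of_le (by
          exact_mod_cast le_top)))
      rw [hT]
      have e1 : ∑ k ∈ Finset.range (n+1), p k (fun _ => y) = ∑ k ∈ Finset.range (n + 1),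
        (k ! : ℝ)⁻¹ • (iteratedFDeriv ℝ k f x (fun _ ↦ y)) := rfl
      rw [e1, sub_add_cancel_left, norm_neg, norm_smul, norm_inv, Real.norm_natCast]
      have hn : (0:ℝ) < (n ! : ℝ) := by positivity
      rw [inv_mul_le_iff₀ hn]
      have hI := intervalIntegral.norm_integral_le_of_norm_le_const (a := 0) (b := 1)
        (f := fun t : ℝ => (1 - t)^n • iteratedFDeriv ℝ (n + 1) f (x + t • y) (fun _ ↦ y))
        (C := M * A^(n+1) * ((n+1)! : ℝ) * ‖y‖^(n+1)) (by
          intro t ht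
          rw [uIoc_of_le zero_le_one] at ht
          rw [norm_smul, norm_pow, Real.norm_of_nonneg (by linarith [ht.2])]
          have h1 : (1 - t)^n ≤ 1 := pow_le_one₀ (by linarith [ht.2]) (by linarith [ht.1])
          have h2 : ‖iteratedFDeriv ℝ (n + 1) f (x + t • y) (fun _ ↦ y)‖ ≤
              M * A^(n+1) * ((n+1)! : ℝ) * ‖y‖^(n+1) := by
            refine ((iteratedFDeriv ℝ (n + 1) f (x + t • y)).le_opNorm _).trans ?_
            simp only [Finset.prod_const, Finset.card_univ, Fintype.card_fin]
            gcongr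
            exact hb _ _ (hseg t ⟨ht.1.le, ht.2⟩)
          calc _ ≤ 1 * _ := mul_le_mul h1 h2 (norm_nonneg _) zero_le_one
            _ = _ := one_mul _)
      refine hI.trans (le_of_eq ?_)
      rw [Nat.factorial_succ]
      push_cast
      simp
      ring
    rw [tendsto_iff_norm_sub_tendsto_zero]
    refine squeeze_zero (fun _ => norm_nonneg _) key ?_
    have := ((tendsto_self_mul_const_pow_of_lt_one hq0 hq).comp (tendsto_add_atTop_nat 1)).const_mul M
    simpa using this

def WeylMVP {E F : Type*} [NormedAddCommGroup E] [NormedSpace ℝ E] [MeasureSpace E]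
    [NormedAddCommGroup F] [NormedSpace ℝ F] (η : E → ℝ) (U : Set E) (v : E → F) : Prop :=
  ∀ (x : E) (r r' : ℝ), 0 < r → r < r' → ball x r' ⊆ U → v x = ∫ z, η z • v (x - r • z)

section
variable {E F : Type*} [NormedAddCommGroup E] [InnerProductSpace ℝ E] [FiniteDimensional ℝ E]
  [MeasurableSpace E] [BorelSpace E]
    [NormedAddCommGroup F] [NormedSpace ℝ F] [CompleteSpace F]

theorem weyl_hset {η : E → ℝ} (hη0 : ∀ z, 1 ≤ ‖z‖ → η z = 0) (g : E → F) :
      ∫ z, η z • g z = ∫ z in closedBall (0:E) 1, η z • g z := by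
  refine (setIntegral_eq_integral_of_forall_compl_eq_zero fun z hz => ?_).symm
  rw [hη0 z (by simp at hz; exact hz.le), zero_smul]

theorem WeylMVP.fderiv {η : E → ℝ} {U : Set E} {v : E → F} (hη : Continuous η)
    (hη0 : ∀ z, 1 ≤ ‖z‖ → η z = 0) (hU : IsOpen U)
    (hv : ContDiffOn ℝ 1 v U) (h : WeylMVP η U v) : WeylMVP η U (fderiv ℝ v) := by
  intro x r r' hr hrr' hsub
  set δ := (r' - r) / 2 with hδ
  have hδ0 : 0 < δ := by rw [hδ]; linarith
  have hK : ∀ x' ∈ ball x δ, ∀ z ∈ closedBall (0:E) 1, x' - r • z ∈ closedBall x (r + δ) := by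
    intro x' hx' z hz
    rw [mem_closedBall, dist_eq_norm]
    have h1 : ‖x' - x‖ < δ := by simpa [dist_eq_norm] using hx'
    have h2 : ‖z‖ ≤ 1 := by simpa using hz
    calc ‖x' - r • z - x‖ = ‖(x' - x) - r • z‖ := by congr 1; abel
      _ ≤ ‖x' - x‖ + ‖r • z‖ := norm_sub_le _ _
      _ ≤ δ + r * 1 := by
        rw [norm_smul, Real.norm_of_nonneg hr.le]; gcongr
      _ = r + δ := by ring
  have hKU : closedBall x (r + δ) ⊆ U :=
    (closedBall_subset_ball (by rw [hδ]; linarith)).trans hsub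
  have hev : v =ᶠ[𝓝 x] fun x' => ∫ z in closedBall (0:E) 1, η z • v (x' - r • z) := by
    filter_upwards [ball_mem_nhds x hδ0] with x' hx'
    rw [← weyl_hset hη0]
    refine h x' r (r + δ) hr (by linarith) (Subset.trans ?_ hsub)
    intro y hy
    rw [mem_ball] at *
    calc dist y x ≤ dist y x' + dist x' x := dist_triangle _ _ _
      _ < r' := by rw [hδ] at *; linarith
  have hcf : ContinuousOn (_root_.fderiv ℝ v) U := hv.continuousOn_fderiv_of_isOpen hU le_rfl
  obtain ⟨B, hB⟩ := (isCompact_closedBall x (r+δ)).exists_bound_of_continuousOn (hcf.mono hKU)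
  obtain ⟨C, hC⟩ := (isCompact_closedBall (0:E) 1).exists_bound_of_continuousOn hη.continuousOn
  have hmv : ∀ x' ∈ ball x δ, ContinuousOn (fun z => η z • v (x' - r • z)) (closedBall (0:E) 1) := by
    intro x' hx'
    refine hη.continuousOn.smul (hv.continuousOn.comp (by fun_prop) ?_)
    exact fun z hz => hKU (hK x' hx' z hz)
  have hmf : ContinuousOn (fun z => η z • _root_.fderiv ℝ v (x - r • z)) (closedBall (0:E) 1) := by
    refine hη.continuousOn.smul (hcf.comp (by fun_prop) ?_)
    exact fun z hz => hKU (hK x (mem_ball_self hδ0) z hz)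
  have hcomp := isCompact_closedBall (0:E) 1
  have hxx := mem_ball_self (x := x) hδ0
  have hd := hasFDerivAt_integral_of_dominated_of_fderiv_le (𝕜 := ℝ)
    (μ := volume.restrict (closedBall (0:E) 1)) (x₀ := x) (s := ball x δ)
    (F := fun x' z => η z • v (x' - r • z)) (F' := fun x' z => η z • _root_.fderiv ℝ v (x' - r • z))
    (bound := fun _ => C * B) (ball_mem_nhds x hδ0)
    (by
      filter_upwards [ball_mem_nhds x hδ0] with x' hx'
      exact (hmv x' hx').aestronglyMeasurable_of_isCompact hcomp
        measurableSet_closedBall)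
    ((hmv x hxx).integrableOn_compact hcomp)
    ((hmf).aestronglyMeasurable_of_isCompact hcomp
        measurableSet_closedBall)
    (by
      filter_upwards [ae_restrict_mem measurableSet_closedBall] with z hz x' hx'
      rw [norm_smul]
      have := hB _ (hK x' hx' z hz)
      have := hC z hz
      have h0 := norm_nonneg (η z)
      gcongr
      linarith)
    (continuousOn_const.integrableOn_compact hcomp)
    (by
      filter_upwards [ae_restrict_mem measurableSet_closedBall] with z hz x' hx'
      have hm := hKU (hK x' hx' z hz)
      have h1 : HasFDerivAt v (_root_.fderiv ℝ v (x' - r • z)) (x' - r • z) :=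
        ((hv.contDiffAt (hU.mem_nhds hm)).differentiableAt (by simp)).hasFDerivAt
      have h2 := h1.comp x' ((hasFDerivAt_id x').sub_const (r • z))
      exact h2.const_smul (η z))
  rw [weyl_hset hη0, (hd.congr_of_eventuallyEq hev).fderiv]

/-- Change of variables from the `z` form to the kernel form. -/
theorem weyl_cov (η : E → ℝ) (v : E → F) (x : E) {r : ℝ} (hr : 0 < r) :
    ∫ z, η z • v (x - r • z) =
      ∫ y, ((r⁻¹) ^ (Module.finrank ℝ E) * η (r⁻¹ • (x - y))) • v y := by
  have h1 := Measure.integral_comp_smul (volume : Measure E)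
    (fun z => η (r⁻¹ • z) • v (x - z)) r
  have h2 := integral_sub_left_eq_self (fun z => η (r⁻¹ • z) • v (x - z)) (volume : Measure E) x
  simp only [sub_sub_cancel] at h2
  rw [← h2] at h1
  simp only [smul_smul, inv_mul_cancel₀ hr.ne', one_smul] at h1
  rw [h1, abs_of_pos (by positivity), ← integral_smul]
  simp only [smul_smul, inv_pow]

theorem WeylMVP.gradient {η : E → ℝ} {U : Set E} {v : E → F} (hη : Continuous η)
    (hη0 : ∀ z, 1 ≤ ‖z‖ → η z = 0) {L : ℝ} (hL0 : 0 ≤ L) (hL : ∀ a b, |η a - η b| ≤ L * ‖a - b‖)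
    (hv : ContinuousOn v U) (h : WeylMVP η U v) {x : E} {R M : ℝ} (hR : 0 < R)
    (hsub : ball x R ⊆ U) (hM : ∀ y ∈ ball x R, ‖v y‖ ≤ M) :
    ‖_root_.fderiv ℝ v x‖ ≤
      (2 * L * (2 ^ (Module.finrank ℝ E) * volume.real (ball (0:E) 1))) / R * M := by
  set d := Module.finrank ℝ E with hd
  set r := R / 2 with hr
  set V := volume.real (ball (0:E) 1) with hV
  have hr0 : 0 < r := by rw [hr]; linarith
  set δ := r / 2 with hδ
  have hδ0 : 0 < δ := by rw [hδ]; linarith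
  have hM0 : 0 ≤ M := (norm_nonneg _).trans (hM x (mem_ball_self hR))
  set S := closedBall x (r + δ) with hS
  have hSR : S ⊆ ball x R := closedBall_subset_ball (by linarith)
  have hScomp : IsCompact S := isCompact_closedBall _ _
  let k : E → E → ℝ := fun x' y => (r⁻¹) ^ d * η (r⁻¹ • (x' - y))
  have hkc : ∀ x', Continuous (k x') := by intro x'; simp only [k]; fun_prop
  have hkl : ∀ x' y, |k x' y - k x y| ≤ r⁻¹ ^ d * (L * (r⁻¹ * ‖x' - x‖)) := by
    intro x' y
    simp only [k]
    rw [← mul_sub, abs_mul, abs_of_pos (by positivity)]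
    gcongr
    refine (hL _ _).trans (le_of_eq ?_)
    rw [← smul_sub, norm_smul, sub_sub_sub_cancel_right, Real.norm_of_nonneg (by positivity)]
  have hrep : ∀ x' ∈ ball x δ, v x' = ∫ y in S, k x' y • v y := by
    intro x' hx'
    rw [mem_ball] at hx'
    rw [h x' r (r + δ) hr0 (by linarith) (Subset.trans (fun y hy => ?_) hsub), weyl_cov _ _ _ hr0]
    · refine (setIntegral_eq_integral_of_forall_compl_eq_zero fun y hy => ?_).symm
      rw [hη0, mul_zero, zero_smul]
      rw [norm_smul, Real.norm_of_nonneg (by positivity), le_inv_mul_iff₀ hr0, mul_one,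
        ← dist_eq_norm]
      have : r + δ < dist y x := by simpa [hS] using hy
      have := dist_triangle y x' x
      rw [dist_comm y x'] at this
      linarith
    · rw [mem_ball] at *
      have := dist_triangle y x' x
      linarith
  have hIntg : ∀ x', IntegrableOn (fun y => k x' y • v y) S := fun x' =>
    ((hkc x').continuousOn.smul (hv.mono (hSR.trans hsub))).integrableOn_compact hScomp
  have hVol : volume.real S ≤ (2 * r) ^ d * V := by
    rw [hS, Measure.addHaar_real_closedBall _ _ (by positivity)]
    gcongr
    linarith
  have hC0 : 0 ≤ (2 * L * (2 ^ d * V)) / R * M := by positivity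
  by_cases hdiff : DifferentiableAt ℝ v x
  · refine hdiff.hasFDerivAt.le_of_lip' hC0 ?_
    filter_upwards [ball_mem_nhds x hδ0] with x' hx'
    rw [hrep x' hx', hrep x (mem_ball_self hδ0), ← integral_sub (hIntg _) (hIntg _)]
    have := norm_setIntegral_le_of_norm_le_const (μ := (volume : Measure E)) (s := S)
      (f := fun y => k x' y • v y - k x y • v y)
      (C := r⁻¹ ^ d * (L * (r⁻¹ * ‖x' - x‖)) * M) hScomp.measure_lt_top (by
        intro y hy
        rw [← sub_smul, norm_smul]
        exact mul_le_mul (hkl x' y) (hM y (hSR hy)) (norm_nonneg _) (by positivity))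
    refine this.trans ?_
    calc _ ≤ r⁻¹ ^ d * (L * (r⁻¹ * ‖x' - x‖)) * M * ((2 * r) ^ d * V) := by gcongr
      _ = _ := by
        have : R = 2 * r := by rw [hr]; ring
        rw [this, inv_pow, mul_pow]
        field_simp
  · rw [fderiv_zero_of_not_differentiableAt hdiff, norm_zero]; exact hC0

theorem WeylMVP.iteratedFDeriv {η : E → ℝ} {U : Set E} {v : E → F} (hη : Continuous η)
    (hη0 : ∀ z, 1 ≤ ‖z‖ → η z = 0) (hU : IsOpen U)
    (hv : ContDiffOn ℝ (⊤ : ℕ∞) v U) (h : WeylMVP η U v) (k : ℕ) :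
    ContDiffOn ℝ (⊤ : ℕ∞) (iteratedFDeriv ℝ k v) U ∧ WeylMVP η U (iteratedFDeriv ℝ k v) := by
  constructor
  · intro y hy
    have := (hv.contDiffAt (hU.mem_nhds hy))
    refine (this.iteratedFDeriv_right (i := k) (m := (⊤ : ℕ∞)) ?_).contDiffWithinAt
    exact_mod_cast le_top
  induction k with
  | zero =>
    intro x r r' h1 h2 h3
    rw [iteratedFDeriv_zero_eq_comp]
    simp only [Function.comp]
    rw [h x r r' h1 h2 h3]
    refine ((continuousMultilinearCurryFin0 ℝ E F).symm.toContinuousLinearEquiv.integral_comp_comm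
      _).symm.trans ?_
    simp
  | succ k ih =>
    have hc : ContDiffOn ℝ 1 (_root_.iteratedFDeriv ℝ k v) U := by
      intro y hy
      have := (hv.contDiffAt (hU.mem_nhds hy))
      refine (this.iteratedFDeriv_right (i := k) (m := 1) ?_).contDiffWithinAt
      exact_mod_cast le_top
    have := WeylMVP.fderiv hη hη0 hU hc ih
    intro x r r' h1 h2 h3
    rw [iteratedFDeriv_succ_eq_comp_left]
    simp only [Function.comp]
    rw [this x r r' h1 h2 h3]
    let e : (E →L[ℝ] E [×k]→L[ℝ] F) ≃L[ℝ] (E [×(k + 1)]→L[ℝ] F) :=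
      (continuousMultilinearCurryLeftEquiv ℝ (fun _ : Fin (k + 1) => E)
        F).symm.toContinuousLinearEquiv
    have he := ContinuousLinearEquiv.integral_comp_comm (𝕜 := ℝ) (μ := (volume : Measure E)) e
      (fun z => η z • _root_.fderiv ℝ (_root_.iteratedFDeriv ℝ k v) (x - r • z))
    refine he.symm.trans ?_
    simp only [map_smul]
    rfl

theorem WeylMVP.analyticAt {η : E → ℝ} {U : Set E} {v : E → F} (hη : Continuous η)
    (hη0 : ∀ z, 1 ≤ ‖z‖ → η z = 0) {L : ℝ} (hL0 : 0 ≤ L) (hL : ∀ a b, |η a - η b| ≤ L * ‖a - b‖)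
    (hU : IsOpen U) (hv : ContDiffOn ℝ (⊤ : ℕ∞) v U) (h : WeylMVP η U v) {x : E} (hx : x ∈ U) :
    AnalyticAt ℝ v x := by
  obtain ⟨ρ, hρ, hρU⟩ : ∃ ρ > 0, closedBall x (2 * ρ) ⊆ U := by
    obtain ⟨ε, hε, h⟩ := nhds_basis_closedBall.mem_iff.1 (hU.mem_nhds hx)
    exact ⟨ε / 2, by linarith, by rwa [mul_div_cancel₀ _ (by norm_num)]⟩
  obtain ⟨M, hM⟩ := (isCompact_closedBall x (2*ρ)).exists_bound_of_continuousOn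
    (hv.continuousOn.mono hρU)
  set C := 2 * L * (2 ^ (Module.finrank ℝ E) * volume.real (ball (0:E) 1)) with hC
  have hC0 : 0 ≤ C := by positivity
  have key : ∀ k : ℕ, ∀ r > 0, ∀ y ∈ closedBall x (2*ρ), ball y (k * r) ⊆ closedBall x (2 * ρ) →
      ‖_root_.iteratedFDeriv ℝ k v y‖ ≤ M * (C / r) ^ k := by
    intro k r hr
    induction k with
    | zero => intro y hy _; simpa using hM y hy
    | succ k ih =>
      intro y hy hsub
      rw [← norm_fderiv_iteratedFDeriv]
      have hkr : 0 ≤ (k:ℝ) * r := by positivity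
      have hsub' : ball y r ⊆ closedBall x (2 * ρ) :=
        (ball_subset_ball (by push_cast; linarith)).trans hsub
      obtain ⟨h1, h2⟩ := WeylMVP.iteratedFDeriv hη hη0 hU hv h k
      refine (WeylMVP.gradient hη hη0 hL0 hL h1.continuousOn h2 hr (hsub'.trans hρU)
        (M := M * (C / r) ^ k) ?_).trans (le_of_eq ?_)
      · intro z hz
        refine ih z (hsub' hz) (Subset.trans ?_ hsub)
        intro a ha
        rw [mem_ball] at *
        have := dist_triangle a z y
        push_cast
        linarith
      · rw [← hC]; ring
  have hM0 : 0 ≤ M := (norm_nonneg _).trans (hM x (mem_closedBall_self (by linarith)))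
  refine weyl_analyticAt_of_bounds v x (ρ := ρ) (M := M) (A := (C + 1) / ρ * Real.exp 1) hρ
    (by positivity) (hv.mono ((ball_subset_closedBall.trans
      (closedBall_subset_closedBall (by linarith))).trans hρU)) ?_
  intro k y hy
  have hyb : y ∈ closedBall x (2 * ρ) := by
    rw [mem_ball] at hy; rw [mem_closedBall]; linarith
  rcases Nat.eq_zero_or_pos k with rfl | hk
  · simpa using hM y hyb
  have hk' : (0:ℝ) < k := by exact_mod_cast hk
  have h1 := key k (ρ / k) (by positivity) y hyb (by
    intro z hz
    rw [mul_div_cancel₀ _ hk'.ne'] at hz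
    rw [mem_ball] at *
    rw [mem_closedBall]
    have := dist_triangle z y x
    linarith)
  refine h1.trans ?_
  have h2 := Real.pow_div_factorial_le_exp (x := k) hk'.le k
  rw [div_le_iff₀ (by positivity)] at h2
  have h3 : Real.exp (k:ℝ) = Real.exp 1 ^ k := by rw [← Real.exp_nat_mul, mul_one]
  rw [h3] at h2
  rw [mul_assoc]
  gcongr
  calc (C / (ρ / k)) ^ k = (C / ρ) ^ k * (k:ℝ)^k := by
        rw [← mul_pow]; congr 1; field_simp
    _ ≤ ((C+1) / ρ) ^ k * (Real.exp 1 ^ k * (k ! : ℝ)) := by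
      gcongr; linarith
    _ = _ := by rw [mul_pow]; ring
end
end partC
section partA
open Metric Set Filter Topology
open scoped ContDiff Nat

theorem weyl_lapE_congr {n : ℕ} {f g : EuclideanSpace ℝ (Fin n) → ℝ} {x : EuclideanSpace ℝ (Fin n)}
    (h : f =ᶠ[𝓝 x] g) : lapE n f x = lapE n g x := by
  unfold lapE
  refine Finset.sum_congr rfl fun i _ => ?_
  have : (fun q => fderiv ℝ f q (EuclideanSpace.single i 1)) =ᶠ[𝓝 x]
      (fun q => fderiv ℝ g q (EuclideanSpace.single i 1)) := by
    filter_upwards [h.fderiv (𝕜 := ℝ)] with q hq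
    rw [hq]
  rw [this.fderiv_eq]

theorem weyl_lapE_zero {n : ℕ} {f : EuclideanSpace ℝ (Fin n) → ℝ} {x : EuclideanSpace ℝ (Fin n)}
    {r : ℝ} (hf : ∀ z, r ≤ ‖z‖ → f z = 0) (hx : r < ‖x‖) : lapE n f x = 0 := by
  have : f =ᶠ[𝓝 x] (fun _ => 0) := by
    filter_upwards [(isOpen_lt continuous_const continuous_norm).mem_nhds hx] with z hz
    exact hf z (le_of_lt hz)
  rw [weyl_lapE_congr this]
  simp [lapE]

theorem weyl_fderiv_scale {n : ℕ} {f : EuclideanSpace ℝ (Fin n) → ℝ} (hf : Differentiable ℝ f)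
    (t : ℝ) (x p v : EuclideanSpace ℝ (Fin n)) :
    fderiv ℝ (fun p => f (t • (x - p))) p v = -t * fderiv ℝ f (t • (x - p)) v := by
  have h1 : HasFDerivAt (fun p : EuclideanSpace ℝ (Fin n) => t • (x - p))
      (t • (-(ContinuousLinearMap.id ℝ (EuclideanSpace ℝ (Fin n))))) p :=
    ((hasFDerivAt_id p).const_sub x).const_smul t
  have h2 := (hf (t • (x - p))).hasFDerivAt.comp p h1
  have h3 : fderiv ℝ (fun p => f (t • (x - p))) p = _ := h2.fderiv
  rw [h3]
  simp

theorem weyl_lapE_scale {n : ℕ} {f : EuclideanSpace ℝ (Fin n) → ℝ} (hf : ContDiff ℝ (⊤ : ℕ∞) f)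
    (t : ℝ) (x p : EuclideanSpace ℝ (Fin n)) :
    lapE n (fun p => f (t • (x - p))) p = t ^ 2 * lapE n f (t • (x - p)) := by
  unfold lapE
  rw [Finset.mul_sum]
  refine Finset.sum_congr rfl fun i _ => ?_
  set e : EuclideanSpace ℝ (Fin n) := EuclideanSpace.single i 1
  have hd : Differentiable ℝ f := hf.differentiable (by simp)
  have hd2 : Differentiable ℝ (fun q => fderiv ℝ f q e) := by
    have : ContDiff ℝ 1 (fderiv ℝ f) := hf.fderiv_right (by norm_cast)
    exact fun q => ((this.differentiable (by simp)) q).clm_apply (differentiableAt_const _)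
  simp_rw [weyl_fderiv_scale hd]
  have : DifferentiableAt ℝ (fun q => (fun q => fderiv ℝ f q e) (t • (x - q))) p :=
    (hd2.comp (g := fun q => fderiv ℝ f q e) (f := fun q => t • (x - q)) (by fun_prop)) p
  rw [fderiv_const_mul this]
  rw [_root_.smul_apply, weyl_fderiv_scale hd2, smul_eq_mul]
  ring

theorem weyl_lapE_psi {n : ℕ} {η ψ : EuclideanSpace ℝ (Fin n) → ℝ} (hη : Differentiable ℝ η)
    (h : ∀ x, HasFDerivAt ψ (η x • innerSL ℝ x) x) (y : EuclideanSpace ℝ (Fin n)) :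
    lapE n ψ y = n * η y + fderiv ℝ η y y := by
  have h1 : ∀ i : Fin n, (fun q => fderiv ℝ ψ q (EuclideanSpace.single i 1)) =
      fun q => η q * q i := by
    intro i; ext q
    rw [(h q).fderiv]
    simp [EuclideanSpace.inner_single_right]
  have h2 : ∀ i : Fin n, fderiv ℝ (fun q : EuclideanSpace ℝ (Fin n) => η q * q i) y
      (EuclideanSpace.single i 1) = η y + y i * fderiv ℝ η y (EuclideanSpace.single i 1) := by
    intro i
    have h3 : HasFDerivAt (fun q : EuclideanSpace ℝ (Fin n) => q i)
        (EuclideanSpace.proj i : EuclideanSpace ℝ (Fin n) →L[ℝ] ℝ) y :=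
      (EuclideanSpace.proj i : EuclideanSpace ℝ (Fin n) →L[ℝ] ℝ).hasFDerivAt
    have h4 := ((hη y).hasFDerivAt.mul h3).fderiv
    have h5 : fderiv ℝ (fun q : EuclideanSpace ℝ (Fin n) => η q * q i) y = _ := h4
    rw [h5]
    simp
  unfold lapE
  simp_rw [h1, h2]
  rw [Finset.sum_add_distrib]
  simp only [Finset.sum_const, Finset.card_univ, Fintype.card_fin, nsmul_eq_mul]
  congr 1
  have h6 : y = ∑ i, y i • (EuclideanSpace.single i (1:ℝ)) := by
    have := (EuclideanSpace.basisFun (Fin n) ℝ).sum_repr y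
    simpa using this.symm
  conv_rhs => rw [h6]
  simp only [map_sum, map_smul, smul_eq_mul]
  rw [← h6]

theorem weyl_kernel {n : ℕ} (hn : 0 < n) : ∃ η ψ : EuclideanSpace ℝ (Fin n) → ℝ,
    ContDiff ℝ (⊤ : ℕ∞) η ∧ ContDiff ℝ (⊤ : ℕ∞) ψ ∧ (∀ x, 1 ≤ ‖x‖ → η x = 0) ∧
    (∀ x, 1 ≤ ‖x‖ → ψ x = 0) ∧ (∫ x, η x = 1) ∧ ∀ x, HasFDerivAt ψ (η x • innerSL ℝ x) x := by
  have hσ : ContDiff ℝ (⊤ : ℕ∞) Real.smoothTransition := Real.smoothTransition.contDiff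
  set g := deriv Real.smoothTransition with hg
  have hgc : ContDiff ℝ (⊤ : ℕ∞) g := (contDiff_infty_iff_deriv.1 hσ).2
  have hg0 : ∀ s, 0 ≤ g s := fun s => Real.smoothTransition.monotone.deriv_nonneg
  have hgz : ∀ s ≤ 0, g s = 0 := by
    intro s hs
    apply IsLocalMin.deriv_eq_zero
    filter_upwards with y
    rw [Real.smoothTransition.zero_of_nonpos hs]
    exact Real.smoothTransition.nonneg y
  obtain ⟨s, hs, hgs⟩ := exists_deriv_eq_slope Real.smoothTransition (zero_lt_one)
    hσ.continuous.continuousOn (hσ.differentiable (by simp)).differentiableOn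
  have hgs' : g s ≠ 0 := by
    rw [hg, hgs, Real.smoothTransition.one, Real.smoothTransition.zero]; norm_num
  let E := EuclideanSpace ℝ (Fin n)
  let η0 : E → ℝ := fun x => g (1 - ‖x‖ ^ 2)
  have hn2 : ContDiff ℝ (⊤ : ℕ∞) (fun x : E => 1 - ‖x‖ ^ 2) :=
    contDiff_const.sub (contDiff_norm_sq ℝ)
  have hη0 : ContDiff ℝ (⊤ : ℕ∞) η0 := hgc.comp hn2
  have hz : ∀ x : E, 1 ≤ ‖x‖ → 1 - ‖x‖ ^ 2 ≤ 0 := by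
    intro x hx; nlinarith
  have hη0z : ∀ x, 1 ≤ ‖x‖ → η0 x = 0 := fun x hx => hgz _ (hz x hx)
  have hcs : HasCompactSupport η0 := by
    refine HasCompactSupport.of_support_subset_isCompact (isCompact_closedBall (0:E) 1) ?_
    intro x hx
    by_contra hc
    exact hx (hη0z x (by simp at hc; exact hc.le))
  have hpos : 0 < ∫ x, η0 x := by
    refine hη0.continuous.integral_pos_of_hasCompactSupport_nonneg_nonzero hcs
      (fun x => hg0 _) (x := EuclideanSpace.single ⟨0, hn⟩ (Real.sqrt (1 - s))) ?_
    have hnorm : ‖(EuclideanSpace.single (⟨0, hn⟩ : Fin n) (Real.sqrt (1 - s)) :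
        EuclideanSpace ℝ (Fin n))‖ = |Real.sqrt (1 - s)| := by simp
    show g (1 - ‖(EuclideanSpace.single (⟨0, hn⟩ : Fin n) (Real.sqrt (1 - s)) :
        EuclideanSpace ℝ (Fin n))‖ ^ 2) ≠ 0
    rw [hnorm, sq_abs, Real.sq_sqrt (by linarith [hs.2])]
    simpa using hgs'
  set c := (∫ x, η0 x)⁻¹ with hc
  refine ⟨fun x => c * η0 x, fun x => -(c/2) * Real.smoothTransition (1 - ‖x‖^2),
    contDiff_const.mul hη0, contDiff_const.mul (hσ.comp hn2), ?_, ?_, ?_, ?_⟩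
  · intro x hx; simp only [hη0z x hx, mul_zero]
  · intro x hx; simp only [Real.smoothTransition.zero_of_nonpos (hz x hx), mul_zero]
  · rw [integral_const_mul, hc, inv_mul_cancel₀ hpos.ne']
  · intro x
    have h1 : HasFDerivAt (fun x : E => 1 - ‖x‖^2) (-((2:ℕ) • innerSL ℝ x)) x :=
      (hasStrictFDerivAt_norm_sq x).hasFDerivAt.const_sub 1
    have h2 : HasDerivAt Real.smoothTransition (g (1 - ‖x‖^2)) (1 - ‖x‖^2) :=
      (hσ.differentiable (by simp) _).hasDerivAt
    have h3 := (h2.comp_hasFDerivAt x h1).const_mul (-(c/2))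
    refine h3.congr_fderiv ?_
    ext v
    simp [η0]
    ring
end partA
section partB
open Metric Set Filter Topology
open scoped ContDiff

theorem weyl_const {n : ℕ} {Ω : Set (EuclideanSpace ℝ (Fin n))} (hΩ : IsOpen Ω)
    {u : EuclideanSpace ℝ (Fin n) → ℝ} (hloc : LocallyIntegrableOn u Ω)
    (hweak : ∀ φ : EuclideanSpace ℝ (Fin n) → ℝ,
      ContDiff ℝ (⊤ : ℕ∞) φ → HasCompactSupport φ → tsupport φ ⊆ Ω →
      ∫ p in Ω, lapE n φ p * u p = 0)
    {η ψ : EuclideanSpace ℝ (Fin n) → ℝ} (hη : ContDiff ℝ (⊤ : ℕ∞) η)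
    (hψ : ContDiff ℝ (⊤ : ℕ∞) ψ) (hη0 : ∀ x, 1 ≤ ‖x‖ → η x = 0)
    (hψ0 : ∀ x, 1 ≤ ‖x‖ → ψ x = 0) (hψη : ∀ x, HasFDerivAt ψ (η x • innerSL ℝ x) x)
    {x : EuclideanSpace ℝ (Fin n)} {s0 : ℝ} (hs0 : 0 < s0) (hK : closedBall x s0⁻¹ ⊆ Ω)
    {t1 t2 : ℝ} (h1 : s0 < t1) (h2 : s0 < t2) :
    ∫ p in Ω, t1 ^ n * η (t1 • (x - p)) * u p = ∫ p in Ω, t2 ^ n * η (t2 • (x - p)) * u p := by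
  set K := closedBall x s0⁻¹ with hKdef
  have hKc : IsCompact K := isCompact_closedBall _ _
  have hu : IntegrableOn u K := hloc.integrableOn_compact_subset hK hKc
  have hdη : Differentiable ℝ η := hη.differentiable (by simp)
  have hdηc : Continuous (fderiv ℝ η) := hη.continuous_fderiv (by simp)
  have hfar : ∀ t, s0 < t → ∀ p, p ∉ K → 1 < ‖t • (x - p)‖ := by
    intro t ht p hp
    have hp' : s0⁻¹ < ‖x - p‖ := by
      rw [hKdef, mem_closedBall, not_le, dist_comm, dist_eq_norm] at hp
      exact hp
    have ht0 : 0 < t := hs0.trans ht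
    rw [norm_smul, Real.norm_eq_abs, abs_of_pos ht0]
    calc (1:ℝ) = s0 * s0⁻¹ := (mul_inv_cancel₀ hs0.ne').symm
      _ < s0 * ‖x - p‖ := by gcongr
      _ ≤ t * ‖x - p‖ := by gcongr
  have hred : ∀ t, s0 < t → ∫ p in Ω, t ^ n * η (t • (x - p)) * u p =
      ∫ p in K, t ^ n * η (t • (x - p)) * u p := by
    intro t ht
    refine setIntegral_eq_of_subset_of_forall_sdiff_eq_zero hΩ.measurableSet hK ?_
    intro p hp
    rw [hη0 _ (hfar t ht p hp.2).le]; simp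
  rw [hred t1 h1, hred t2 h2]
  let Λ : EuclideanSpace ℝ (Fin n) → ℝ := fun y => n * η y + fderiv ℝ η y y
  have hΛc : Continuous Λ :=
    (continuous_const.mul hη.continuous).add (hdηc.clm_apply continuous_id)
  have hΛ : ∀ y, lapE n ψ y = Λ y := fun y => weyl_lapE_psi hdη hψη y
  have key : ∀ t ∈ Ioi s0,
      HasDerivAt (fun t => ∫ p in K, t ^ n * η (t • (x - p)) * u p) 0 t := by
    intro t ht
    have ht0 : 0 < t := hs0.trans ht
    have hzero : ∫ p in K, t⁻¹ * t ^ n * Λ (t • (x - p)) * u p = 0 := by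
      have hφs : Function.support (fun p => ψ (t • (x - p))) ⊆ K := by
        intro p hp
        by_contra hc
        exact hp (hψ0 _ (hfar t ht p hc).le)
      have hw := hweak (fun p => ψ (t • (x - p))) (hψ.comp (by fun_prop))
        (HasCompactSupport.of_support_subset_isCompact hKc hφs)
        ((closure_minimal hφs hKc.isClosed).trans hK)
      have hw2 : ∫ p in Ω, lapE n (fun p => ψ (t • (x - p))) p * u p =
          ∫ p in K, lapE n (fun p => ψ (t • (x - p))) p * u p := by
        refine setIntegral_eq_of_subset_of_forall_sdiff_eq_zero hΩ.measurableSet hK ?_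
        intro p hp
        rw [weyl_lapE_scale hψ, weyl_lapE_zero hψ0 (hfar t ht p hp.2)]; simp
      rw [hw2] at hw
      have : (fun p => t⁻¹ * t ^ n * Λ (t • (x - p)) * u p) =
          fun p => (t⁻¹ * t ^ n * (t ^ 2)⁻¹) * (lapE n (fun p => ψ (t • (x - p))) p * u p) := by
        ext p
        rw [weyl_lapE_scale hψ, hΛ]
        field_simp
      rw [this, integral_const_mul, hw, mul_zero]
    have hcont : ContinuousOn (fun q : ℝ × EuclideanSpace ℝ (Fin n) =>
        q.1⁻¹ * q.1 ^ n * Λ (q.1 • (x - q.2))) (Icc s0 (t + 1) ×ˢ K) := by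
      refine ContinuousOn.mul (ContinuousOn.mul ?_ (by fun_prop))
        (Continuous.continuousOn (by fun_prop))
      exact continuousOn_fst.inv₀ fun q hq => (hs0.trans_le hq.1.1).ne'
    obtain ⟨C, hC⟩ := (isCompact_Icc.prod hKc).exists_bound_of_continuousOn hcont
    have hηc := hη.continuous
    have hF := hasDerivAt_integral_of_dominated_loc_of_deriv_le
      (μ := volume.restrict K) (F := fun t p => t ^ n * η (t • (x - p)) * u p)
      (F' := fun t p => t⁻¹ * t ^ n * Λ (t • (x - p)) * u p) (x₀ := t)
      (bound := fun p => C * ‖u p‖) (s := Ioo s0 (t + 1))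
      (Ioo_mem_nhds ht (by linarith)) ?_ ?_ ?_ ?_ ?_ ?_
    · rw [hzero] at hF
      exact hF.2
    · filter_upwards with s
      exact (Continuous.aestronglyMeasurable (by fun_prop)).mul hu.aestronglyMeasurable
    · exact IntegrableOn.continuousOn_mul (Continuous.continuousOn (by fun_prop)) hu hKc
    · exact (Continuous.aestronglyMeasurable (by fun_prop)).mul hu.aestronglyMeasurable
    · filter_upwards [ae_restrict_mem hKc.measurableSet] with p hp s hs
      rw [norm_mul]
      gcongr
      exact hC (s, p) ⟨⟨hs.1.le, hs.2.le⟩, hp⟩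
    · exact hu.norm.const_mul C
    · filter_upwards with p s hs
      have hs' : 0 < s := hs0.trans hs.1
      have e1 : HasDerivAt (fun s : ℝ => s • (x - p)) (x - p) s := by
        simpa using (hasDerivAt_id s).smul_const (x - p)
      have e2 : HasDerivAt (fun s : ℝ => η (s • (x - p))) _ s :=
        (hdη (s • (x - p))).hasFDerivAt.comp_hasDerivAt s e1
      have e3 := ((hasDerivAt_pow n s).mul e2).mul_const (u p)
      refine e3.congr_deriv ?_
      simp only [Λ, map_smul, smul_eq_mul]
      rcases n with _ | m
      · simp; field_simp; simp
      · simp only [Nat.add_sub_cancel]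
        field_simp
        ring
  have hd : ∀ t ∈ Ioi s0, DifferentiableAt ℝ
      (fun t => ∫ p in K, t ^ n * η (t • (x - p)) * u p) t :=
    fun t ht => (key t ht).differentiableAt
  exact isOpen_Ioi.is_const_of_deriv_eq_zero isPreconnected_Ioi
    (fun t ht => (hd t ht).differentiableWithinAt) (fun t ht => (key t ht).deriv) h1 h2

theorem weyl_lebesgue {n : ℕ} {η : EuclideanSpace ℝ (Fin n) → ℝ} (hη : ContDiff ℝ (⊤ : ℕ∞) η)
    (hη0 : ∀ x, 1 ≤ ‖x‖ → η x = 0) (hη1 : ∫ x, η x = 1)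
    {g : EuclideanSpace ℝ (Fin n) → ℝ} (hg : LocallyIntegrable g) :
    ∀ᵐ x, Tendsto (fun t : ℝ => ∫ y, (t ^ n * η (t • (x - y))) • g y) atTop (𝓝 (g x)) := by
  have hcs : HasCompactSupport η := by
    refine HasCompactSupport.of_support_subset_isCompact (isCompact_closedBall 0 1) ?_
    intro x hx
    by_contra hc
    exact hx (hη0 x (by simp at hc; exact hc.le))
  obtain ⟨C, hC⟩ := hcs.exists_bound_of_continuous hη.continuous
  filter_upwards [(Besicovitch.vitaliFamily volume).ae_tendsto_average_norm_sub hg] with x h0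
  have := (h0.comp (Besicovitch.tendsto_filterAt volume x)).comp tendsto_inv_atTop_nhdsGT_zero
  apply tendsto_integral_smul_of_tendsto_average_norm_sub
    (C * volume.real (ball (0 : EuclideanSpace ℝ (Fin n)) 1)) this
  · filter_upwards with i using hg.integrableOn_isCompact (isCompact_closedBall _ _)
  · apply tendsto_const_nhds.congr'
    filter_upwards [eventually_gt_atTop 0] with t ht
    have h := weyl_cov η (fun _ => (1:ℝ)) x (inv_pos.2 ht)
    simp only [inv_inv, smul_eq_mul, mul_one, finrank_euclideanSpace_fin] at h
    rw [← h, hη1]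
  · filter_upwards [eventually_gt_atTop 0] with t ht
    intro y hy
    by_contra hc
    apply hy
    simp only [mem_closedBall, not_le, dist_comm y x, dist_eq_norm] at hc
    have : 1 ≤ ‖t • (x - y)‖ := by
      rw [norm_smul, Real.norm_eq_abs, abs_of_pos ht]
      calc (1:ℝ) = t * t⁻¹ := (mul_inv_cancel₀ ht.ne').symm
        _ ≤ t * ‖x - y‖ := by gcongr
    simp [hη0 _ this]
  · filter_upwards [eventually_gt_atTop 0] with t ht y
    have hpos : 0 < volume.real (ball (0 : EuclideanSpace ℝ (Fin n)) 1) :=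
      ENNReal.toReal_pos (measure_ball_pos _ _ one_pos).ne' measure_ball_lt_top.ne
    rw [Measure.addHaar_real_closedBall _ _ (inv_pos.2 ht).le, finrank_euclideanSpace_fin,
      abs_mul, abs_of_pos (pow_pos ht n)]
    have := hC (t • (x - y))
    rw [Real.norm_eq_abs] at this
    rw [inv_pow, div_eq_mul_inv, mul_inv, inv_inv]
    calc t ^ n * |η (t • (x - y))| ≤ t ^ n * C := by gcongr
      _ = _ := by field_simp

theorem weyl_I_eq {n : ℕ} {Ω K : Set (EuclideanSpace ℝ (Fin n))} (hΩ : IsOpen Ω)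
    {u k : EuclideanSpace ℝ (Fin n) → ℝ} (hK : IsCompact K) (hKΩ : K ⊆ Ω)
    (hk : ∀ p, p ∉ K → k p = 0) :
    ∫ p in Ω, k p * u p = ∫ p, k p • K.indicator u p := by
  rw [setIntegral_eq_of_subset_of_forall_sdiff_eq_zero hΩ.measurableSet hKΩ
    (fun p hp => by rw [hk p hp.2, zero_mul]), ← integral_indicator hK.measurableSet]
  congr 1
  ext p
  by_cases hp : p ∈ K
  · simp [hp]
  · simp [hp]

theorem weyl_far {n : ℕ} {x p : EuclideanSpace ℝ (Fin n)} {r t : ℝ} (hr : 0 < r)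
    (ht : r⁻¹ < t) (h : r ≤ ‖x - p‖) : 1 < ‖t • (x - p)‖ := by
  have ht0 : 0 < t := (inv_pos.2 hr).trans ht
  rw [norm_smul, Real.norm_eq_abs, abs_of_pos ht0]
  calc (1:ℝ) = r⁻¹ * r := (inv_mul_cancel₀ hr.ne').symm
      _ < t * r := by gcongr
      _ ≤ t * ‖x - p‖ := by gcongr

theorem weyl_farK {n : ℕ} {x x0 p : EuclideanSpace ℝ (Fin n)} {R : ℝ}
    (hx : x ∈ ball x0 R) (hp : p ∉ closedBall x0 (2 * R)) : R ≤ ‖x - p‖ := by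
  rw [mem_closedBall, not_le] at hp
  rw [mem_ball] at hx
  rw [← dist_eq_norm]
  linarith [dist_triangle p x x0, dist_comm p x]

theorem weyl_indicator_loc {n : ℕ} {Ω K : Set (EuclideanSpace ℝ (Fin n))}
    {u : EuclideanSpace ℝ (Fin n) → ℝ} (hloc : LocallyIntegrableOn u Ω)
    (hK : IsCompact K) (hKΩ : K ⊆ Ω) : LocallyIntegrable (K.indicator u) :=
  ((integrable_indicator_iff hK.measurableSet).2
    (hloc.integrableOn_compact_subset hKΩ hK)).locallyIntegrable

theorem weyl_exists_R {n : ℕ} {Ω : Set (EuclideanSpace ℝ (Fin n))} (hΩ : IsOpen Ω)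
    {x0 : EuclideanSpace ℝ (Fin n)} (hx0 : x0 ∈ Ω) :
    ∃ R, 0 < R ∧ closedBall x0 (2 * R) ⊆ Ω := by
  obtain ⟨ε, hε, h⟩ := nhds_basis_closedBall.mem_iff.1 (hΩ.mem_nhds hx0)
  exact ⟨ε / 2, by positivity, by rwa [mul_div_cancel₀ _ two_ne_zero]⟩

theorem weyl_ae_tendsto {n : ℕ} {Ω : Set (EuclideanSpace ℝ (Fin n))} (hΩ : IsOpen Ω)
    {u : EuclideanSpace ℝ (Fin n) → ℝ} (hloc : LocallyIntegrableOn u Ω)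
    {η : EuclideanSpace ℝ (Fin n) → ℝ} (hη : ContDiff ℝ (⊤ : ℕ∞) η)
    (hη0 : ∀ x, 1 ≤ ‖x‖ → η x = 0) (hη1 : ∫ x, η x = 1) :
    ∀ᵐ x ∂(volume.restrict Ω),
      Tendsto (fun t : ℝ => ∫ p in Ω, t ^ n * η (t • (x - p)) * u p) atTop (𝓝 (u x)) := by
  rw [ae_restrict_iff' hΩ.measurableSet, ae_iff]
  refine measure_null_of_locally_null _ fun x0 hx0 => ?_
  have hx0Ω : x0 ∈ Ω := by
    by_contra hc
    exact hx0 (fun h => absurd h hc)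
  obtain ⟨R, hR, hRΩ⟩ := weyl_exists_R hΩ hx0Ω
  have hKc : IsCompact (closedBall x0 (2 * R)) := isCompact_closedBall _ _
  have hae := weyl_lebesgue hη hη0 hη1 (weyl_indicator_loc hloc hKc hRΩ)
  rw [ae_iff] at hae
  refine ⟨_, inter_mem_nhdsWithin _ (ball_mem_nhds x0 hR), measure_mono_null ?_ hae⟩
  rintro x ⟨hx1, hx2⟩ hx3
  apply hx1
  intro _
  have hxK : x ∈ closedBall x0 (2 * R) :=
    (ball_subset_closedBall.trans (closedBall_subset_closedBall (by linarith))) hx2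
  rw [indicator_of_mem hxK] at hx3
  refine hx3.congr' ?_
  filter_upwards [eventually_gt_atTop R⁻¹] with t ht
  rw [weyl_I_eq (k := fun p => t ^ n * η (t • (x - p))) hΩ hKc hRΩ]
  intro p hp
  simp only [hη0 _ (weyl_far hR ht (weyl_farK hx2 hp)).le, mul_zero]

theorem weyl_fderiv_conv {n : ℕ} {g κ : EuclideanSpace ℝ (Fin n) → ℝ} (hg : LocallyIntegrable g)
    (hκ : ContDiff ℝ (⊤ : ℕ∞) κ) (hc : HasCompactSupport κ) (q v : EuclideanSpace ℝ (Fin n)) :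
    fderiv ℝ (convolution g κ (ContinuousLinearMap.mul ℝ ℝ)) q v =
      (convolution g (fun a => fderiv ℝ κ a v) (ContinuousLinearMap.mul ℝ ℝ)) q := by
  have h1 : HasFDerivAt (convolution g κ (ContinuousLinearMap.mul ℝ ℝ)) _ q :=
    hc.hasFDerivAt_convolution_right (ContinuousLinearMap.mul ℝ ℝ) hg
      (hκ.of_le (by norm_cast)) q
  rw [h1.fderiv]
  exact convolution_precompR_apply (ContinuousLinearMap.mul ℝ ℝ) hg (hc.fderiv ℝ)
    (hκ.continuous_fderiv (by simp)) q v

theorem weyl_lapE_conv {n : ℕ} {g κ : EuclideanSpace ℝ (Fin n) → ℝ} (hg : LocallyIntegrable g)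
    (hκ : ContDiff ℝ (⊤ : ℕ∞) κ) (hc : HasCompactSupport κ) (q : EuclideanSpace ℝ (Fin n)) :
    lapE n (convolution g κ (ContinuousLinearMap.mul ℝ ℝ)) q =
      ∫ p, g p * lapE n κ (q - p) := by
  have hκ1 : ∀ v, ContDiff ℝ (⊤ : ℕ∞) (fun a => fderiv ℝ κ a v) := fun v =>
    (hκ.fderiv_right (m := (⊤ : ℕ∞)) (by norm_cast)).clm_apply contDiff_const
  have hc1 : ∀ v, HasCompactSupport (fun a => fderiv ℝ κ a v) := fun v => hc.fderiv_apply ℝ v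
  have hκ2 : ∀ v, Continuous (fun a => fderiv ℝ (fun b => fderiv ℝ κ b v) a v) := fun v =>
    ((hκ1 v).continuous_fderiv (by simp)).clm_apply continuous_const
  unfold lapE
  have e1 : ∀ v, (fun q => fderiv ℝ (convolution g κ (ContinuousLinearMap.mul ℝ ℝ)) q v) =
      convolution g (fun a => fderiv ℝ κ a v) (ContinuousLinearMap.mul ℝ ℝ) :=
    fun v => funext fun q => weyl_fderiv_conv hg hκ hc q v
  simp_rw [e1, Finset.mul_sum]
  simp only [weyl_fderiv_conv hg (hκ1 _) (hc1 _)]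
  rw [integral_finset_sum]
  · rfl
  · intro i _
    exact ((hc1 _).fderiv_apply ℝ _).convolutionExists_right
      (ContinuousLinearMap.mul ℝ ℝ) hg (hκ2 _) q

theorem weyl_main {n : ℕ} (hn : 0 < n) (Ω : Set (EuclideanSpace ℝ (Fin n))) (hΩ : IsOpen Ω)
    (u : EuclideanSpace ℝ (Fin n) → ℝ) (hloc : LocallyIntegrableOn u Ω)
    (hweak : ∀ φ : EuclideanSpace ℝ (Fin n) → ℝ,
      ContDiff ℝ (⊤ : ℕ∞) φ → HasCompactSupport φ → tsupport φ ⊆ Ω →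
      ∫ p in Ω, lapE n φ p * u p = 0) :
    ∃ w : EuclideanSpace ℝ (Fin n) → ℝ,
      (∀ᵐ x ∂(volume.restrict Ω), u x = w x) ∧
      ContDiffOn ℝ (⊤ : ℕ∞) w Ω ∧ AnalyticOnNhd ℝ w Ω ∧
      ∀ x ∈ Ω, lapE n w x = 0 := by
  obtain ⟨η, ψ, hη, hψ, hη0, hψ0, hη1, hψη⟩ := weyl_kernel hn
  have hηs : HasCompactSupport η := by
    refine HasCompactSupport.of_support_subset_isCompact (isCompact_closedBall 0 1) ?_
    intro x hx
    by_contra hc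
    exact hx (hη0 x (by simp at hc; exact hc.le))
  let w : EuclideanSpace ℝ (Fin n) → ℝ := fun x =>
    limUnder atTop (fun t : ℝ => ∫ p in Ω, t ^ n * η (t • (x - p)) * u p)
  have hwI : ∀ x s0 t, 0 < s0 → closedBall x s0⁻¹ ⊆ Ω → s0 < t →
      w x = ∫ p in Ω, t ^ n * η (t • (x - p)) * u p := by
    intro x s0 t hs0 hK ht
    refine Tendsto.limUnder_eq (tendsto_const_nhds.congr' ?_)
    filter_upwards [eventually_gt_atTop s0] with t' ht'
    exact weyl_const hΩ hloc hweak hη hψ hη0 hψ0 hψη hs0 hK ht ht'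
  have hwu : ∀ᵐ x ∂(volume.restrict Ω), u x = w x := by
    filter_upwards [weyl_ae_tendsto hΩ hloc hη hη0 hη1] with x hx
    exact hx.limUnder_eq.symm
  have hconv : ∀ x0 ∈ Ω, ∃ f : EuclideanSpace ℝ (Fin n) → ℝ, w =ᶠ[𝓝 x0] f ∧
      ContDiff ℝ (⊤ : ℕ∞) f ∧ lapE n f x0 = 0 := by
    intro x0 hx0
    obtain ⟨R, hR, hRΩ⟩ := weyl_exists_R hΩ hx0
    have hKc : IsCompact (closedBall x0 (2 * R)) := isCompact_closedBall _ _
    have hg := weyl_indicator_loc hloc hKc hRΩ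
    set K := closedBall x0 (2 * R) with hKdef
    set t := 2 * R⁻¹ with htdef
    have htR : R⁻¹ < t := by have := inv_pos.2 hR; linarith
    let κ : EuclideanSpace ℝ (Fin n) → ℝ := fun z => t ^ n * η (t • z)
    have hκ : ContDiff ℝ (⊤ : ℕ∞) κ := contDiff_const.mul (hη.comp (by fun_prop))
    have hκ0 : ∀ z, R ≤ ‖z‖ → κ z = 0 := by
      intro z hz
      have := weyl_far (x := z) (p := 0) hR htR (by simpa using hz)
      rw [sub_zero] at this
      simp only [κ, hη0 _ this.le, mul_zero]
    have hκ0' : ∀ z, R * (3/4) ≤ ‖z‖ → κ z = 0 := by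
      intro z hz
      have hlt : (R * (3/4))⁻¹ < t := by
        rw [htdef, mul_inv, mul_comm]
        have := inv_pos.2 hR
        gcongr
        norm_num
      have := weyl_far (x := z) (p := 0) (by positivity) hlt (by simpa using hz)
      rw [sub_zero] at this
      simp only [κ, hη0 _ this.le, mul_zero]
    have hκs : HasCompactSupport κ := by
      refine HasCompactSupport.of_support_subset_isCompact (isCompact_closedBall 0 R) ?_
      intro x hx
      by_contra hc
      exact hx (hκ0 x (by simp at hc; exact hc.le))
    refine ⟨convolution (K.indicator u) κ (ContinuousLinearMap.mul ℝ ℝ), ?_, ?_, ?_⟩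
    · filter_upwards [ball_mem_nhds x0 hR] with x hx
      rw [hwI x R⁻¹ t (inv_pos.2 hR) ?_ htR,
        weyl_I_eq (k := fun p => t ^ n * η (t • (x - p))) hΩ hKc hRΩ]
      · rw [convolution_def]
        congr 1
        ext p
        simp only [ContinuousLinearMap.mul_apply', smul_eq_mul, κ]
        ring
      · intro p hp
        exact hκ0 (x - p) (weyl_farK hx hp)
      · rw [inv_inv]
        refine Subset.trans (closedBall_subset_closedBall' ?_) hRΩ
        rw [mem_ball] at hx
        linarith
    · exact hκs.contDiff_convolution_right _ hg hκ
    · rw [weyl_lapE_conv hg hκ hκs]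
      have hlap : ∀ p, lapE n (fun p => κ ((1:ℝ) • (x0 - p))) p = lapE n κ (x0 - p) := by
        intro p
        rw [weyl_lapE_scale hκ]; simp
      have hmem : x0 ∈ ball x0 R := mem_ball_self hR
      have hs : Function.support (fun p => κ ((1:ℝ) • (x0 - p))) ⊆ K := by
        intro p hp
        by_contra hc
        apply hp
        simp only [one_smul]
        exact hκ0 _ (weyl_farK hmem hc)
      have hw := hweak (fun p => κ ((1:ℝ) • (x0 - p))) (hκ.comp (by fun_prop))
        (HasCompactSupport.of_support_subset_isCompact hKc hs)
        ((closure_minimal hs hKc.isClosed).trans hRΩ)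
      simp_rw [hlap] at hw
      rw [weyl_I_eq (k := fun p => lapE n κ (x0 - p)) hΩ hKc hRΩ] at hw
      · rw [← hw]
        congr 1
        ext p
        rw [smul_eq_mul, mul_comm]
      · intro p hp
        exact weyl_lapE_zero hκ0' (by linarith [weyl_farK hmem hp])
  have hsmooth : ContDiffOn ℝ (⊤ : ℕ∞) w Ω := by
    intro x hx
    obtain ⟨f, hwf, hf, -⟩ := hconv x hx
    exact (hf.contDiffAt.congr_of_eventuallyEq hwf).contDiffWithinAt
  have hmvp : WeylMVP η Ω w := by
    intro x r r' hr hrr' hball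
    set r2 := (r + r') / 2 with hr2
    have hr2p : 0 < r2 := by rw [hr2]; linarith
    have hrr2 : r < r2 := by rw [hr2]; linarith
    have hr2r : r2 < r' := by rw [hr2]; linarith
    rw [hwI x r2⁻¹ r⁻¹ (inv_pos.2 hr2p)
      (by rw [inv_inv]; exact (closedBall_subset_ball hr2r).trans hball)
      (by gcongr), weyl_cov η w x hr, finrank_euclideanSpace_fin]
    have e1 : ∫ p in Ω, r⁻¹ ^ n * η (r⁻¹ • (x - p)) * u p =
        ∫ p in Ω, r⁻¹ ^ n * η (r⁻¹ • (x - p)) * w p := by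
      refine integral_congr_ae ?_
      filter_upwards [hwu] with p hp
      rw [hp]
    rw [e1]
    refine setIntegral_eq_integral_of_forall_compl_eq_zero fun p hp => ?_
    have hp1 : r2 ≤ ‖x - p‖ := by
      by_contra hc
      apply hp
      apply hball
      rw [mem_ball, dist_comm, dist_eq_norm]
      linarith
    rw [hη0 _ (weyl_far hr2p (by gcongr) hp1).le]
    simp
  obtain ⟨L, hL⟩ := hη.lipschitzWith_of_hasCompactSupport hηs (by simp)
  have hana : AnalyticOnNhd ℝ w Ω := fun x hx =>
    hmvp.analyticAt hη.continuous hη0 L.coe_nonneg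
      (fun a b => by simpa [dist_eq_norm, Real.dist_eq] using hL.dist_le_mul a b) hΩ hsmooth hx
  refine ⟨w, hwu, hsmooth, hana, fun x hx => ?_⟩
  obtain ⟨f, hwf, -, hf⟩ := hconv x hx
  rw [weyl_lapE_congr hwf, hf]

end partB

/-- Weyl's lemma: if `u` is locally integrable on the open set `Ω ⊆ ℝⁿ` and
`∫_Ω (Δφ) u = 0` for all `φ ∈ C_c^∞(Ω)`, then `u` agrees a.e. on `Ω` with a `C^∞`
(indeed harmonic, hence real analytic) function. -/
theorem stmt_9 {n : ℕ} (Ω : Set (EuclideanSpace ℝ (Fin n))) (hΩ : IsOpen Ω)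
    (u : EuclideanSpace ℝ (Fin n) → ℝ) (hloc : LocallyIntegrableOn u Ω)
    (hweak : ∀ φ : EuclideanSpace ℝ (Fin n) → ℝ,
      ContDiff ℝ (⊤ : ℕ∞) φ → HasCompactSupport φ → tsupport φ ⊆ Ω →
      ∫ p in Ω, lapE n φ p * u p = 0) :
    ∃ w : EuclideanSpace ℝ (Fin n) → ℝ,
      (∀ᵐ x ∂(volume.restrict Ω), u x = w x) ∧
      ContDiffOn ℝ (⊤ : ℕ∞) w Ω ∧ AnalyticOnNhd ℝ w Ω ∧
      ∀ x ∈ Ω, lapE n w x = 0 := by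
  rcases Nat.eq_zero_or_pos n with rfl | hn
  · have hu : u = fun _ => u 0 := by
      ext x
      rw [Subsingleton.elim x 0]
    refine ⟨u, Filter.Eventually.of_forall fun x => rfl, ?_, ?_, ?_⟩
    · rw [hu]; exact contDiffOn_const
    · rw [hu]; exact fun x _ => analyticAt_const
    · intro x _
      simp [lapE]
  · exact weyl_main hn Ω hΩ u hloc hweak
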